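/- Let 0 < λ ≤ Λ, n ≥ 1, x₀ ∈ ℝⁿ, r > 0, and define u : ℝⁿ → ℝ by u(y) = (1/Λ)·(ωₙ/(2n(n+2)))·(r^{n+2} − ‖y − x₀‖^{n+2}). Then u vanishes on ∂B_r(x₀), and for every x ∈ B_r(x₀) the Hessian matrix D²u(x) of u at x (in the standard basis) is negative semidefinite and satisfies M⁻(D²u(x)) = −|{y ∈ B_r(x₀) : u(y) ≥ u(x)}|, where M⁻(M) = λ·Σ_{eᵢ>0} eᵢ + Λ·Σ_{eᵢ<0} eᵢ with eᵢ the eigenvalues of M. That is, u is an explicit classical solution of the Pucci equation M⁻(D²u(x)) = −|{u ≥ u(x)}| in B_r(x₀) with zero Dirichlet boundary values. -/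

import Mathlib

open MeasureTheory Metric Finset Matrix

section NormPow

variable {E : Type*} [NormedAddCommGroup E] [InnerProductSpace ℝ E]

theorem hasFDerivAt_norm_of_ne_zero {w : E} (hw : w ≠ 0) :
    HasFDerivAt (fun z : E => ‖z‖) (‖w‖⁻¹ • innerSL ℝ w) w := by
  have hw' : ‖w‖ ≠ 0 := norm_ne_zero_iff.mpr hw
  have h := (hasStrictFDerivAt_norm_sq w).hasFDerivAt.sqrt (pow_ne_zero 2 hw')
  simp only [Real.sqrt_sq (norm_nonneg _)] at h
  convert h using 1
  ext v
  simp
  field_simp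

theorem hasFDerivAt_norm_pow_add_two (n : ℕ) (w : E) :
    HasFDerivAt (fun z : E => ‖z‖ ^ (n + 2)) (((n + 2 : ℝ) * ‖w‖ ^ n) • innerSL ℝ w) w := by
  have h := hasFDerivAt_norm_rpow w (p := (n : ℝ) + 2)
    (by have := n.cast_nonneg (α := ℝ); linarith)
  rw [add_sub_cancel_right, Real.rpow_natCast] at h
  refine h.congr_of_eventuallyEq (.of_forall fun z => ?_)
  simp only [← Real.rpow_natCast]
  push_cast
  rfl

/-- At `w = 0` the coefficient `‖w‖⁻¹` is zero, which is the right value since `n ≠ 0`. -/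
theorem hasFDerivAt_norm_pow_mul_inner {n : ℕ} (hn : n ≠ 0) (v w : E) :
    HasFDerivAt (fun z : E => ‖z‖ ^ n * inner ℝ z v)
      (‖w‖ ^ n • innerSL ℝ v + (n * ‖w‖ ^ (n - 1) * ‖w‖⁻¹ * inner ℝ w v) • innerSL ℝ w) w := by
  rcases eq_or_ne w 0 with rfl | hw
  · have h0 : HasFDerivAt (fun z : E => ‖z‖ ^ n * inner ℝ z v) (0 : E →L[ℝ] ℝ) 0 := by
      refine Asymptotics.IsBigO.hasFDerivAt (n := n + 1) ?_ (by omega)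
      refine Asymptotics.IsBigO.of_bound ‖v‖ (.of_forall fun z => ?_)
      simp only [norm_mul, norm_pow, norm_norm, sub_zero]
      calc ‖z‖ ^ n * ‖inner ℝ z v‖ ≤ ‖z‖ ^ n * (‖z‖ * ‖v‖) := by
            gcongr
            exact norm_inner_le_norm z v
        _ = ‖v‖ * ‖z‖ ^ (n + 1) := by ring
    simpa [hn] using h0
  · have h1 := (hasFDerivAt_norm_of_ne_zero hw).pow n
    have h2 : HasFDerivAt (fun z : E => inner ℝ z v) (innerSL ℝ v) w := by
      refine (innerSL ℝ v).hasFDerivAt.congr_of_eventuallyEq (.of_forall fun z => ?_)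
      exact real_inner_comm v z
    refine (h1.mul h2).congr_fderiv ?_
    ext z
    simp
    ring

end NormPow

theorem Matrix.IsHermitian.eigenvalues_nonpos {ι : Type*} [Fintype ι] [DecidableEq ι]
    {A : Matrix ι ι ℝ} (hA : A.IsHermitian) (h : ∀ ξ : ι → ℝ, ξ ⬝ᵥ (A *ᵥ ξ) ≤ 0) (i : ι) :
    hA.eigenvalues i ≤ 0 := by
  rw [hA.eigenvalues_eq]
  simpa using h (hA.eigenvectorBasis i)

/-- On negative semidefinite matrices the Pucci operator is a multiple of the trace. -/
theorem Matrix.IsHermitian.pucci_eq_mul_trace {ι : Type*} [Fintype ι] [DecidableEq ι]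
    {A : Matrix ι ι ℝ} (hA : A.IsHermitian) (h : ∀ ξ : ι → ℝ, ξ ⬝ᵥ (A *ᵥ ξ) ≤ 0)
    (lam Lam : ℝ) :
    lam * ∑ i ∈ univ.filter (fun i => 0 < hA.eigenvalues i), hA.eigenvalues i
      + Lam * ∑ i ∈ univ.filter (fun i => hA.eigenvalues i < 0), hA.eigenvalues i
      = Lam * A.trace := by
  have hpos : univ.filter (fun i => 0 < hA.eigenvalues i) = ∅ :=
    filter_eq_empty_iff.mpr fun i _ => (hA.eigenvalues_nonpos h i).not_gt
  have hneg : ∑ i ∈ univ.filter (fun i => hA.eigenvalues i < 0), hA.eigenvalues i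
      = ∑ i, hA.eigenvalues i :=
    sum_filter_of_ne fun i _ hi => lt_of_le_of_ne (hA.eigenvalues_nonpos h i) hi
  rw [hpos, hneg, hA.trace_eq_sum_eigenvalues]
  simp

/-- The quadratic form of `-a (s I + t w wᵀ)` is nonpositive for `a, s, t ≥ 0`. -/
theorem dotProduct_mulVec_nonpos_of_eq {ι : Type*} [Fintype ι] [DecidableEq ι]
    {A : Matrix ι ι ℝ} {a s t : ℝ} {w : ι → ℝ} (ha : 0 ≤ a) (hs : 0 ≤ s) (ht : 0 ≤ t)
    (hA : A = -a • (s • (1 : Matrix ι ι ℝ) + t • vecMulVec w w)) (ξ : ι → ℝ) :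
    ξ ⬝ᵥ (A *ᵥ ξ) ≤ 0 := by
  have h : ξ ⬝ᵥ (A *ᵥ ξ) = -(a * (s * (ξ ⬝ᵥ ξ) + t * (ξ ⬝ᵥ w) ^ 2)) := by
    rw [hA, smul_mulVec, add_mulVec, smul_mulVec, smul_mulVec, one_mulVec, vecMulVec_mulVec]
    simp [dotProduct_comm w ξ]
    ring
  have hξ : 0 ≤ ξ ⬝ᵥ ξ := by simpa using dotProduct_star_self_nonneg ξ
  rw [h, neg_nonpos]
  positivity

theorem fderiv_radial {E : Type*} [NormedAddCommGroup E] [InnerProductSpace ℝ E] {n : ℕ}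
    {c R : ℝ} {x₀ : E} {u : E → ℝ} (hu : ∀ y, u y = c * (R - ‖y - x₀‖ ^ (n + 2))) (z v : E) :
    fderiv ℝ u z v = -(c * (n + 2)) * (‖z - x₀‖ ^ n * inner ℝ (z - x₀) v) := by
  have h : HasFDerivAt (fun y => ‖y - x₀‖ ^ (n + 2))
      (((n + 2 : ℝ) * ‖z - x₀‖ ^ n) • innerSL ℝ (z - x₀)) z :=
    (hasFDerivAt_comp_sub x₀).mpr (hasFDerivAt_norm_pow_add_two n (z - x₀))
  rw [funext hu, ((h.const_sub R).const_mul c).fderiv]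
  simp [inner_sub_left]
  ring

theorem fderiv_fderiv_radial {E : Type*} [NormedAddCommGroup E] [InnerProductSpace ℝ E] {n : ℕ}
    (hn : n ≠ 0) {c R : ℝ} {x₀ : E} {u : E → ℝ}
    (hu : ∀ y, u y = c * (R - ‖y - x₀‖ ^ (n + 2))) (x v v' : E) :
    fderiv ℝ (fun z => fderiv ℝ u z v) x v' = -(c * (n + 2)) * (‖x - x₀‖ ^ n * inner ℝ v v' +
      n * ‖x - x₀‖ ^ (n - 1) * ‖x - x₀‖⁻¹ * inner ℝ (x - x₀) v * inner ℝ (x - x₀) v') := by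
  have h : HasFDerivAt (fun z => ‖z - x₀‖ ^ n * inner ℝ (z - x₀) v) _ x :=
    (hasFDerivAt_comp_sub x₀).mpr (hasFDerivAt_norm_pow_mul_inner hn v (x - x₀))
  rw [funext fun z => fderiv_radial hu z v, (h.const_mul _).fderiv]
  simp [inner_sub_left]
  ring

/-- For `0 < λ ≤ Λ`, the function
`u(y) = (1/Λ)·(ωₙ/(2n(n+2)))·(r^(n+2) − ‖y − x₀‖^(n+2))` vanishes on `∂B_r(x₀)`, and for every
`x ∈ B_r(x₀)` its Hessian matrix `D²u(x)` (in the standard basis) is negative semidefinite and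
satisfies the Pucci equation
`M⁻(D²u(x)) = λ·Σ_{eᵢ>0} eᵢ + Λ·Σ_{eᵢ<0} eᵢ = −|{y ∈ B_r(x₀) : u(y) ≥ u(x)}|`. -/
theorem pucci_radial_solution (n : ℕ) (hn : 1 ≤ n) (lam Lam : ℝ)
    (hlam : 0 < lam) (hle : lam ≤ Lam)
    (x₀ : EuclideanSpace ℝ (Fin n)) (r : ℝ) (hr : 0 < r)
    (ω : ℝ) (hω : ω = (volume (ball (0 : EuclideanSpace ℝ (Fin n)) 1)).toReal)
    (u : EuclideanSpace ℝ (Fin n) → ℝ)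
    (hu : ∀ y, u y = (1 / Lam) * (ω / (2 * n * (n + 2))) * (r ^ (n + 2) - ‖y - x₀‖ ^ (n + 2)))
    (H : EuclideanSpace ℝ (Fin n) → Matrix (Fin n) (Fin n) ℝ)
    (hH : ∀ x i j, H x i j =
      fderiv ℝ (fun z => fderiv ℝ u z (EuclideanSpace.single j 1)) x
        (EuclideanSpace.single i 1)) :
    (∀ y ∈ sphere x₀ r, u y = 0) ∧
      ∀ x ∈ ball x₀ r,
        ∃ hHerm : (H x).IsHermitian,
          (∀ ξ : Fin n → ℝ, ξ ⬝ᵥ ((H x) *ᵥ ξ) ≤ 0) ∧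
          lam * ∑ i ∈ univ.filter (fun i => 0 < hHerm.eigenvalues i), hHerm.eigenvalues i
            + Lam * ∑ i ∈ univ.filter (fun i => hHerm.eigenvalues i < 0), hHerm.eigenvalues i
          = -(volume {y ∈ ball x₀ r | u x ≤ u y}).toReal := by
  have hLam : 0 < Lam := hlam.trans_le hle
  have hn0 : n ≠ 0 := by omega
  have hω0 : 0 < ω := by
    rw [hω]
    exact ENNReal.toReal_pos (measure_ball_pos _ _ one_pos).ne' measure_ball_lt_top.ne
  have hnR : (0 : ℝ) < n := by exact_mod_cast hn
  set c : ℝ := (1 / Lam) * (ω / (2 * n * (n + 2))) with hc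
  have hc0 : 0 < c := by positivity
  refine ⟨fun y hy => by simp [hu, mem_sphere_iff_norm.mp hy], fun x hx => ?_⟩
  set w : Fin n → ℝ := fun i => (x - x₀) i with hw
  set t : ℝ := n * ‖x - x₀‖ ^ (n - 1) * ‖x - x₀‖⁻¹ with ht
  have hHx : H x = -(c * (n + 2)) • (‖x - x₀‖ ^ n • (1 : Matrix (Fin n) (Fin n) ℝ)
      + t • vecMulVec w w) := by
    ext i j
    rw [hH, fderiv_fderiv_radial hn0 hu]
    simp [vecMulVec_apply, Matrix.one_apply, EuclideanSpace.inner_single_right, hw, ht,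
      PiLp.single_apply, mul_add]
    ring_nf
    simp
  have hww : w ⬝ᵥ w = ‖x - x₀‖ ^ 2 := by
    rw [EuclideanSpace.real_norm_sq_eq]
    simp [dotProduct, hw, sq]
  have htr : Lam * (H x).trace = -(ω * ‖x - x₀‖ ^ n) := by
    have htw : t * ‖x - x₀‖ ^ 2 = n * ‖x - x₀‖ ^ n := by
      rcases eq_or_ne ‖x - x₀‖ 0 with h0 | h0
      · simp [h0, hn0]
      · rw [ht, ← pow_sub_one_mul hn0 ‖x - x₀‖]
        field_simp
    have h : (H x).trace = -(c * (n + 2)) * (‖x - x₀‖ ^ n * n + t * ‖x - x₀‖ ^ 2) := by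
      rw [hHx, trace_smul, trace_add, trace_smul, trace_smul, trace_one, trace_vecMulVec, hww]
      simp
    rw [h, htw, hc]
    field_simp
    ring
  have hset : {y ∈ ball x₀ r | u x ≤ u y} = closedBall x₀ ‖x - x₀‖ := by
    have hxr : ‖x - x₀‖ < r := mem_ball_iff_norm.mp hx
    ext y
    rw [Set.mem_ofPred_eq, mem_ball_iff_norm, mem_closedBall_iff_norm, hu, hu,
      mul_le_mul_iff_right₀ hc0, sub_le_sub_iff_left,
      pow_le_pow_iff_left₀ (norm_nonneg _) (norm_nonneg _) (by omega)]
    exact ⟨fun h => h.2, fun h => ⟨h.trans_lt hxr, h⟩⟩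
  have hvol : (volume {y ∈ ball x₀ r | u x ≤ u y}).toReal = ω * ‖x - x₀‖ ^ n := by
    rw [hset, Measure.addHaar_closedBall _ _ (norm_nonneg _), ENNReal.toReal_mul,
      ENNReal.toReal_ofReal (by positivity), finrank_euclideanSpace_fin, hω, mul_comm]
  have hHerm : (H x).IsHermitian := by
    rw [hHx]
    ext i j
    simp [vecMulVec_apply, Matrix.one_apply, eq_comm, mul_comm (w i), mul_add]
  have hneg : ∀ ξ : Fin n → ℝ, ξ ⬝ᵥ ((H x) *ᵥ ξ) ≤ 0 :=
    dotProduct_mulVec_nonpos_of_eq (by positivity) (by positivity) (by positivity) hHx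
  exact ⟨hHerm, hneg, by rw [hHerm.pucci_eq_mul_trace hneg, htr, hvol]⟩
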